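/- For every irrational real number x with continued fraction x = [n_0; n_1, n_2, …], the set Γ(x) equals W − (W₁ ∪ W₂), where W = {γ ∈ PGL₂(ℤ) : −1 ≤ γ(∞) ≤ 0 and γ(x) > 1}, W₁ = { [[0,−1],[1,−1−n_0]] } (the unique element of W with γ(∞) = 0 and det γ = 1), and W₂ = { [[−1,1+n_0],[1,−n_0]] } if n_1 ≥ 2 while W₂ = ∅ if n_1 = 1 (the elements of W with γ(∞) = −1 and det γ = −1). -/

import Mathlib

open Polynomial Matrix

noncomputable section

abbrev Mat2 := Matrix (Fin 2) (Fin 2) ℤ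

/-- The matrix `Tⁿ = [[1,n],[0,1]]`. -/
def Tpow (n : ℤ) : Mat2 := !![1, n; 0, 1]

/-- The matrix `ε = [[0,1],[1,0]]`. -/
def Meps : Mat2 := !![0, 1; 1, 0]

/-- The matrix `S = [[0,-1],[1,0]]`. -/
def MS : Mat2 := !![0, -1; 1, 0]

/-- The matrix `T = [[1,1],[0,1]]`. -/
def MT : Mat2 := !![1, 1; 0, 1]

/-- The matrix `σ = [[-1,0],[0,1]]`. -/
def Msig : Mat2 := !![-1, 0; 0, 1]

/-- The matrix `U = TS = [[1,-1],[1,0]]`. -/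
def MU : Mat2 := MT * MS

/-- Möbius action of an integer matrix on a real number. -/
def moeb (M : Mat2) (x : ℝ) : ℝ :=
  ((M 0 0 : ℝ) * x + (M 0 1 : ℝ)) / ((M 1 0 : ℝ) * x + (M 1 1 : ℝ))

/-- The sequence `x_i` of the (positive) continued fraction algorithm:
`x_0 = x`, `x_{i+1} = 1/(x_i - ⌊x_i⌋)`. -/
def cfX (x : ℝ) : ℕ → ℝ
  | 0 => x
  | i + 1 => 1 / (cfX x i - (⌊cfX x i⌋ : ℝ))

/-- The partial quotients `n_i = ⌊x_i⌋` of the continued fraction of `x`. -/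
def cfN (x : ℝ) (i : ℕ) : ℤ := ⌊cfX x i⌋

/-- The matrices `γ_0 = Id`, `γ_{i+1} = ε T^{-n_i} γ_i`. -/
def gam (x : ℝ) : ℕ → Mat2
  | 0 => 1
  | i + 1 => (Meps * Tpow (-(cfN x i))) * gam x i

/-- `Γ(x) = {γ_1, γ_2, γ_3, …}`. -/
def GammaSet (x : ℝ) : Set Mat2 := {M | ∃ i, 1 ≤ i ∧ M = gam x i}

/-- The matrices `γ'_0 = Id`, `γ'_{i+1} = Tγ'_i` if `γ'_i(x) ≤ 0`,
`T^{-1}εγ'_i` if `0 < γ'_i(x) ≤ 1`, and `T^{-1}γ'_i` if `γ'_i(x) > 1`. -/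
def gam' (x : ℝ) : ℕ → Mat2
  | 0 => 1
  | i + 1 =>
    if moeb (gam' x i) x ≤ 0 then MT * gam' x i
    else if moeb (gam' x i) x ≤ 1 then (Tpow (-1) * Meps) * gam' x i
    else Tpow (-1) * gam' x i

/-- `Γ(x)' = {γ'_1, γ'_2, γ'_3, …}`. -/
def GammaSet' (x : ℝ) : Set Mat2 := {M | ∃ i, 1 ≤ i ∧ M = gam' x i}

/-- The sequence `x_i` of the negative continued fraction algorithm:
`x_0 = x`, `x_{i+1} = 1/(⌈x_i⌉ - x_i)`. -/
def ncfX (x : ℝ) : ℕ → ℝ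
  | 0 => x
  | i + 1 => 1 / ((⌈ncfX x i⌉ : ℝ) - ncfX x i)

/-- The partial quotients `m_i = ⌈x_i⌉` of the negative continued fraction of `x`. -/
def ncfM (x : ℝ) (i : ℕ) : ℤ := ⌈ncfX x i⌉

/-- The matrices `γ̃_0 = Id`, `γ̃_{i+1} = S T^{-m_i} γ̃_i`. -/
def gamt (x : ℝ) : ℕ → Mat2
  | 0 => 1
  | i + 1 => (MS * Tpow (-(ncfM x i))) * gamt x i

/-- `Γ₁(x) = {γ̃_1, γ̃_2, γ̃_3, …}`. -/
def Gamma1Set (x : ℝ) : Set Mat2 := {M | ∃ i, 1 ≤ i ∧ M = gamt x i}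

/-- A binary quadratic polynomial `aX² + bX + c`, encoded as the triple `(a,b,c)`. -/
abbrev QF := ℤ × ℤ × ℤ

/-- The value of `aX² + bX + c` at a real number `x`. -/
def Qval (q : QF) (x : ℝ) : ℝ := (q.1 : ℝ) * x ^ 2 + (q.2.1 : ℝ) * x + (q.2.2 : ℝ)

/-- The value of `aX² + bX + c` at an integer `m`. -/
def QvalZ (q : QF) (m : ℤ) : ℤ := q.1 * m ^ 2 + q.2.1 * m + q.2.2

/-- The discriminant `b² - 4ac`. -/
def Qdisc (q : QF) : ℤ := q.2.1 ^ 2 - 4 * q.1 * q.2.2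

/-- The homogenized value `a r² + b r t + c t²`; for `t ≠ 0` its sign is that of `Q(r/t)`,
and for `t = 0` that of the leading coefficient, i.e. of `Q(∞)`. -/
def Qhom (q : QF) (r t : ℤ) : ℤ := q.1 * r ^ 2 + q.2.1 * r * t + q.2.2 * t ^ 2

/-- The weight 2 action `(Q|γ)(X) = (tX+u)² Q((rX+s)/(tX+u))` on quadratic polynomials,
for `γ = [[r,s],[t,u]]`. -/
def qslash (M : Mat2) (q : QF) : QF :=
  (Qhom q (M 0 0) (M 1 0),
   2 * q.1 * M 0 0 * M 0 1 + q.2.1 * (M 0 0 * M 1 1 + M 0 1 * M 1 0) + 2 * q.2.2 * M 1 0 * M 1 1,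
   Qhom q (M 0 1) (M 1 1))

/-- The set `𝒬` of integral quadratic polynomials with positive non-square discriminant. -/
def Qset : Set QF := {q | 0 < Qdisc q ∧ ¬ IsSquare (Qdisc q)}

/-- `A` is a `Γ`-equivalence class in `𝒬`, where `Γ = PGL₂(ℤ)`. -/
def IsClassQ (A : Set QF) : Prop :=
  ∃ q₀ ∈ Qset, A = {q ∈ Qset | ∃ M : Mat2, IsUnit M.det ∧ q = qslash M q₀}

/-- `B` is a `Γ₁`-equivalence class in `𝒬`, where `Γ₁ = PSL₂(ℤ)`. -/
def IsClassQ1 (B : Set QF) : Prop :=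
  ∃ q₀ ∈ Qset, B = {q ∈ Qset | ∃ M : Mat2, M.det = 1 ∧ q = qslash M q₀}

/-- `A^Sim = {Q ∈ A : Q(0) < 0 < Q(∞)}`. -/
def QSim (A : Set QF) : Set QF := {q ∈ A | q.2.2 < 0 ∧ 0 < q.1}

/-- `A^Red = {Q ∈ A : Q(∞) > 0, Q(-1) < 0 < Q(0)}`. -/
def QRed (A : Set QF) : Set QF := {q ∈ A | 0 < q.1 ∧ q.1 - q.2.1 + q.2.2 < 0 ∧ 0 < q.2.2}

/-- `A⟨x⟩ = {Q ∈ A : Q(∞) < 0 < Q(x)}`. -/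
def QxSet (A : Set QF) (x : ℝ) : Set QF := {q ∈ A | q.1 < 0 ∧ 0 < Qval q x}

/-- `𝒬_D⟨x⟩`, the set of quadratics of discriminant `D` with `Q(∞) < 0 < Q(x)`. -/
def QDx (D : ℕ) (x : ℝ) : Set QF :=
  {q | Qdisc q = (D : ℤ) ∧ q.1 < 0 ∧ 0 < Qval q x}

/-- The simple forms of discriminant `D`: `a > 0 > c`. -/
def SimpleD (D : ℕ) : Set QF := {q | Qdisc q = (D : ℤ) ∧ 0 < q.1 ∧ q.2.2 < 0}

/-- The reduced forms of discriminant `D`: `a > 0`, `c > 0`, `b > a + c`. -/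
def ReducedD (D : ℕ) : Set QF :=
  {q | Qdisc q = (D : ℤ) ∧ 0 < q.1 ∧ 0 < q.2.2 ∧ q.1 + q.2.2 < q.2.1}

/-- Homogenized evaluation of a polynomial of degree ≤ d: `∑ P_j r^j t^{d-j}`;
for `t ≠ 0` its sign is that of `P(r/t)` (`d` even), and for `t = 0` that of `P(∞)`. -/
def homEval (d : ℕ) (P : Polynomial ℤ) (r t : ℤ) : ℤ :=
  ∑ j ∈ Finset.range (d + 1), P.coeff j * r ^ j * t ^ (d - j)

/-- The weight `d` action `(P|γ)(X) = (tX+u)^d P((rX+s)/(tX+u))` on integral polynomials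
of degree at most `d`, for `γ = [[r,s],[t,u]]`. -/
def pslash (d : ℕ) (M : Mat2) (P : Polynomial ℤ) : Polynomial ℤ :=
  ∑ j ∈ Finset.range (d + 1),
    C (P.coeff j) * (C (M 0 0) * X + C (M 0 1)) ^ j * (C (M 1 0) * X + C (M 1 1)) ^ (d - j)

/-- `P` has exactly two real roots `w ≠ w'`, both irrational. -/
def HasTwoIrratRoots (P : Polynomial ℤ) (w w' : ℝ) : Prop :=
  w ≠ w' ∧ Irrational w ∧ Irrational w' ∧ ∀ y : ℝ, Polynomial.aeval y P = 0 ↔ y = w ∨ y = w'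

/-- `F_d`: integral polynomials of degree ≤ d with exactly two real roots, both irrational. -/
def Fd (d : ℕ) : Set (Polynomial ℤ) :=
  {P | P.natDegree ≤ d ∧ ∃ w w' : ℝ, HasTwoIrratRoots P w w'}

/-- `A` is a `Γ`-equivalence class in `F_d`, where `Γ = PGL₂(ℤ)`. -/
def IsClassF (d : ℕ) (A : Set (Polynomial ℤ)) : Prop :=
  ∃ P₀ ∈ Fd d, A = {P ∈ Fd d | ∃ M : Mat2, IsUnit M.det ∧ P = pslash d M P₀}

/-- `B` is a `Γ₁`-equivalence class in `F_d`, where `Γ₁ = PSL₂(ℤ)`. -/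
def IsClassF1 (d : ℕ) (B : Set (Polynomial ℤ)) : Prop :=
  ∃ P₀ ∈ Fd d, B = {P ∈ Fd d | ∃ M : Mat2, M.det = 1 ∧ P = pslash d M P₀}

/-- `A^Sim = {P ∈ A : P(0) < 0 < P(∞)}`, where `P(∞)` is the coefficient of `X^d`. -/
def PSim (d : ℕ) (A : Set (Polynomial ℤ)) : Set (Polynomial ℤ) :=
  {P ∈ A | P.coeff 0 < 0 ∧ 0 < P.coeff d}

/-- `A^Red = {P ∈ A : P(∞) > 0 and P(-1) < 0 < P(0)}`. -/
def PRed (d : ℕ) (A : Set (Polynomial ℤ)) : Set (Polynomial ℤ) :=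
  {P ∈ A | 0 < P.coeff d ∧ Polynomial.aeval (-1 : ℤ) P < 0 ∧ 0 < P.coeff 0}

/-- `A⟨x⟩ = {P ∈ A : P(∞) < 0 < P(x)}`. -/
def Px (d : ℕ) (A : Set (Polynomial ℤ)) (x : ℝ) : Set (Polynomial ℤ) :=
  {P ∈ A | P.coeff d < 0 ∧ 0 < Polynomial.aeval x P}

/-- The numerators of the convergents, shifted by 2: `pconv x i = p_{i-2}`. -/
def pconv (x : ℝ) : ℕ → ℤ
  | 0 => 0
  | 1 => 1
  | i + 2 => cfN x i * pconv x (i + 1) + pconv x i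

/-- The denominators of the convergents, shifted by 2: `qconv x i = q_{i-2}`. -/
def qconv (x : ℝ) : ℕ → ℤ
  | 0 => 1
  | 1 => 0
  | i + 2 => cfN x i * qconv x (i + 1) + qconv x i

/-- `δ_i = (-1)^i (p_{i-1} - q_{i-1} x)` for `i ≥ 0`. -/
def cfDelta (x : ℝ) (i : ℕ) : ℝ :=
  (-1 : ℝ) ^ i * ((pconv x (i + 1) : ℝ) - (qconv x (i + 1) : ℝ) * x)

/-- The weight `d` action `(P|γ)(X) = (tX+u)^d P((rX+s)/(tX+u))` on complex polynomials
of degree at most `d`, for `γ = [[r,s],[t,u]]` with integer entries. -/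
def cslash (d : ℕ) (M : Mat2) (P : Polynomial ℂ) : Polynomial ℂ :=
  ∑ j ∈ Finset.range (d + 1),
    C (P.coeff j) * (C (M 0 0 : ℂ) * X + C (M 0 1 : ℂ)) ^ j *
      (C (M 1 0 : ℂ) * X + C (M 1 1 : ℂ)) ^ (d - j)

/-- `P^Γ(x) = ∑_{γ ∈ Γ(x)} (P|γ)(x)` for `P` of degree ≤ 2k. -/
def PGam (k : ℕ) (P : Polynomial ℂ) (x : ℝ) : ℂ :=
  ∑' γ : GammaSet x, Polynomial.eval (x : ℂ) (cslash (2 * k) γ.1 P)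

lemma irrational_cfX {x : ℝ} (hx : Irrational x) (i : ℕ) : Irrational (cfX x i) := by
  induction i with
  | zero => exact hx
  | succ i ih =>
    rw [cfX, one_div]
    exact (ih.sub_intCast _).inv

lemma one_lt_cfX_succ {x : ℝ} (hx : Irrational x) (i : ℕ) : 1 < cfX x (i + 1) := by
  have h := irrational_cfX hx i
  have h1 : (⌊cfX x i⌋ : ℝ) < cfX x i := lt_of_le_of_ne (Int.floor_le _) (h.ne_int _).symm
  have h2 := Int.lt_floor_add_one (cfX x i)
  rw [cfX, one_lt_div (by linarith)]
  linarith

lemma one_le_cfN_succ {x : ℝ} (hx : Irrational x) (i : ℕ) : 1 ≤ cfN x (i + 1) := by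
  rw [cfN, Int.le_floor]
  exact_mod_cast (one_lt_cfX_succ hx i).le

lemma Meps_mul_Tpow_neg_mul (n : ℤ) (M : Mat2) :
    Meps * Tpow (-n) * M = !![M 1 0, M 1 1; M 0 0 - n * M 1 0, M 0 1 - n * M 1 1] := by
  ext i j
  fin_cases i <;> fin_cases j <;> simp [Meps, Tpow, Matrix.mul_apply, Fin.sum_univ_two] <;> ring

lemma gam_succ (x : ℝ) (i : ℕ) :
    gam x (i + 1) = !![gam x i 1 0, gam x i 1 1;
      gam x i 0 0 - cfN x i * gam x i 1 0, gam x i 0 1 - cfN x i * gam x i 1 1] := by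
  rw [gam, Meps_mul_Tpow_neg_mul]

lemma gam_one (x : ℝ) : gam x 1 = !![0, 1; 1, -cfN x 0] := by
  rw [gam_succ]
  simp [gam]

lemma gam_two (x : ℝ) :
    gam x 2 = !![1, -cfN x 0; -cfN x 1, 1 + cfN x 1 * cfN x 0] := by
  rw [gam_succ, gam_one]
  simp

lemma isUnit_det_gam (x : ℝ) (i : ℕ) : IsUnit (gam x i).det := by
  induction i with
  | zero => simp [gam]
  | succ i ih =>
    rw [gam, Matrix.det_mul]
    refine IsUnit.mul ?_ ih
    simp [Meps, Tpow]

lemma linear_ne_zero {x : ℝ} (hx : Irrational x) {t u : ℤ} (h : t ≠ 0 ∨ u ≠ 0) :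
    (t : ℝ) * x + u ≠ 0 := by
  by_cases ht : t = 0
  · subst ht
    simpa using h
  · exact ((hx.intCast_mul ht).add_intCast u).ne_zero

lemma moeb_neg (M : Mat2) (x : ℝ) : moeb (-M) x = moeb M x := by
  simp only [moeb, Matrix.neg_apply, Int.cast_neg]
  rw [← neg_div_neg_eq]
  ring_nf

lemma moeb_gam {x : ℝ} (hx : Irrational x) (i : ℕ) : moeb (gam x i) x = cfX x i := by
  induction i with
  | zero => simp [gam, moeb, cfX]
  | succ i ih =>
    have hd := isUnit_det_gam x i
    rw [Matrix.det_fin_two] at hd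
    have hne : gam x i 1 0 ≠ 0 ∨ gam x i 1 1 ≠ 0 := by
      by_contra! h
      simp [h.1, h.2] at hd
    have hl := linear_ne_zero hx hne
    rw [cfX, ← ih, gam_succ]
    change _ = 1 / (_ - ((⌊_⌋ : ℤ) : ℝ))
    rw [ih, show ⌊cfX x i⌋ = cfN x i from rfl, ← ih]
    simp only [moeb, Matrix.of_apply, Matrix.cons_val', Matrix.cons_val_zero, Matrix.cons_val_one,
      Matrix.cons_val_fin_one]
    rw [div_sub' hl, one_div_div]
    push_cast
    ring_nf

lemma gam_succ_column {x : ℝ} (hx : Irrational x) (i : ℕ) :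
    (gam x (i + 1) 0 0 ≤ 0 ∧ 0 < gam x (i + 1) 1 0 ∧
      -gam x (i + 1) 0 0 ≤ gam x (i + 1) 1 0) ∨
    (0 ≤ gam x (i + 1) 0 0 ∧ gam x (i + 1) 1 0 < 0 ∧
      gam x (i + 1) 0 0 ≤ -gam x (i + 1) 1 0) := by
  induction i with
  | zero => simp [gam_one]
  | succ i ih =>
    have hn := one_le_cfN_succ hx i
    rw [gam_succ x (i + 1)]
    simp only [Matrix.of_apply, Matrix.cons_val', Matrix.cons_val_zero, Matrix.cons_val_one,
      Matrix.cons_val_fin_one]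
    rcases ih with ⟨h1, h2, h3⟩ | ⟨h1, h2, h3⟩
    · right
      refine ⟨h2.le, ?_, ?_⟩ <;> nlinarith
    · left
      refine ⟨h2.le, ?_, ?_⟩ <;> nlinarith

lemma gam_add_three_column {x : ℝ} (hx : Irrational x) (i : ℕ) :
    gam x (i + 3) 0 0 ≠ 0 ∧ |gam x (i + 3) 0 0| < |gam x (i + 3) 1 0| := by
  have hn := one_le_cfN_succ hx (i + 1)
  have h1 := gam_succ_column hx i
  have h2 := gam_succ_column hx (i + 1)
  have h3 : gam x (i + 1 + 1) 0 0 = gam x (i + 1) 1 0 := by rw [gam_succ x (i + 1)]; rfl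
  rw [gam_succ x (i + 2)]
  simp only [Matrix.of_apply, Matrix.cons_val', Matrix.cons_val_zero, Matrix.cons_val_one,
      Matrix.cons_val_fin_one]
  simp only [add_assoc, Nat.reduceAdd] at *
  refine ⟨by omega, ?_⟩
  rcases h2 with ⟨h4, h5, h6⟩ | ⟨h4, h5, h6⟩
  · rw [abs_of_pos h5]
    refine lt_of_lt_of_le ?_ (neg_le_abs _)
    have : gam x (i + 2) 0 0 < 0 := by omega
    nlinarith
  · rw [abs_of_neg h5]
    refine lt_of_lt_of_le ?_ (le_abs_self _)
    have : 0 < gam x (i + 2) 0 0 := by omega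
    nlinarith

lemma one_lt_and_floor_of_inv {y : ℝ} (hy : 1 < y) {n : ℤ} (hn : 1 ≤ n) :
    1 < n + 1 / y ∧ ⌊n + 1 / y⌋ = n := by
  have h0 : 0 < 1 / y := by positivity
  have h1 : 1 / y < 1 := by rw [div_lt_one (by linarith)]; exact hy
  have h2 : (1 : ℝ) ≤ n := by exact_mod_cast hn
  refine ⟨by linarith, ?_⟩
  rw [Int.floor_eq_iff]
  constructor <;> linarith

lemma moeb_predecessor {x : ℝ} {a b t u n : ℤ} (h : 1 < moeb !![-a, b; t, u] x) :
    moeb !![-(t - n * a), -(u + n * b); a, -b] x = n + 1 / moeb !![-a, b; t, u] x := by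
  simp only [moeb, Matrix.of_apply, Matrix.cons_val', Matrix.cons_val_zero, Matrix.cons_val_one,
      Matrix.cons_val_fin_one] at *
  have hb : (a : ℝ) * x + -b ≠ 0 := by
    intro h0
    have : ((-a : ℤ) : ℝ) * x + b = 0 := by push_cast; linarith
    rw [this, zero_div] at h
    linarith
  rw [one_div_div]
  push_cast
  rw [show (-(a : ℝ) * x + b) = -(a * x + -b) by ring, div_neg, eq_add_neg_iff_add_eq,
    ← add_div, div_eq_iff hb]
  ring

lemma eq_gam_succ_of_predecessor {x : ℝ} (hx : Irrational x) {a b t u n : ℤ} (hn : 1 ≤ n)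
    (h : 1 < moeb !![-a, b; t, u] x) {i : ℕ}
    (hi : !![-(t - n * a), -(u + n * b); a, -b] = gam x i ∨
      !![-(t - n * a), -(u + n * b); a, -b] = -gam x i) :
    !![-a, b; t, u] = gam x (i + 1) ∨ !![-a, b; t, u] = -gam x (i + 1) := by
  have hX : cfX x i = n + 1 / moeb !![-a, b; t, u] x := by
    rw [← moeb_predecessor h, ← moeb_gam hx]
    rcases hi with hi | hi <;> rw [hi]
    rw [moeb_neg]
  have hN : cfN x i = n := by
    rw [cfN, hX]
    exact (one_lt_and_floor_of_inv h hn).2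
  rcases hi with hi | hi
  · right
    rw [gam_succ, hN, ← hi]
    ext j k
    fin_cases j <;> fin_cases k <;> simp
  · left
    rw [gam_succ, hN, ← neg_eq_iff_eq_neg.mpr hi]
    ext j k
    fin_cases j <;> fin_cases k <;> simp

lemma eq_gam_of_top_left_zero {x : ℝ} {b u : ℤ} (hb : b = 1 ∨ b = -1)
    (h : 1 < moeb !![0, b; 1, u] x) :
    !![0, b; 1, u] = gam x 1 ∨ !![0, b; 1, u] = !![0, -1; 1, -(1 + cfN x 0)] := by
  simp only [moeb, Matrix.of_apply, Matrix.cons_val', Matrix.cons_val_zero, Matrix.cons_val_one,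
      Matrix.cons_val_fin_one] at h
  have hu : cfN x 0 = ⌊x⌋ := rfl
  rw [gam_one]
  rcases hb with rfl | rfl
  · left
    push_cast at h
    simp only [zero_mul, zero_add, one_mul] at h
    have hp : 0 < x + u := by
      by_contra! hc
      have := div_nonpos_of_nonneg_of_nonpos zero_le_one hc
      linarith
    rw [one_lt_div hp] at h
    have : ⌊x⌋ = -u := by
      rw [Int.floor_eq_iff]; push_cast; constructor <;> linarith
    rw [hu, this, neg_neg]
  · right
    push_cast at h
    simp only [zero_mul, zero_add, one_mul] at h
    have hp : x + u < 0 := by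
      by_contra! hc
      have := div_nonpos_of_nonpos_of_nonneg (by norm_num : (-1 : ℝ) ≤ 0) hc
      linarith
    rw [lt_div_iff_of_neg hp] at h
    have : ⌊x⌋ = -u - 1 := by
      rw [Int.floor_eq_iff]; push_cast; constructor <;> linarith
    rw [hu, this, show -(1 + (-u - 1)) = u by ring]

lemma eq_gam_of_top_left_neg_one {x : ℝ} (hx : Irrational x) {b u : ℤ}
    (hb : u + b = 1 ∨ u + b = -1) (h : 1 < moeb !![-1, b; 1, u] x) :
    !![-1, b; 1, u] = -gam x 2 ∨
      2 ≤ cfN x 1 ∧ !![-1, b; 1, u] = !![-1, 1 + cfN x 0; 1, -(cfN x 0)] := by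
  simp only [moeb, Matrix.of_apply, Matrix.cons_val', Matrix.cons_val_zero, Matrix.cons_val_one,
      Matrix.cons_val_fin_one] at h
  have hu : cfN x 0 = ⌊x⌋ := rfl
  have hn1 : cfN x 1 = ⌊1 / (x - cfN x 0)⌋ := rfl
  have hne := linear_ne_zero hx (t := 1) (u := u) (Or.inl one_ne_zero)
  rw [gam_two]
  push_cast at h hne
  rw [one_mul] at h hne
  rcases hb with hb | hb
  · right
    obtain rfl : b = 1 - u := by omega
    have e : (-1 * x + ((1 - u : ℤ) : ℝ)) / (x + u) = 1 / (x + u) - 1 := by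
      push_cast; field_simp; ring
    rw [e] at h
    have hp : 0 < x + u := by
      by_contra! hc
      have := div_nonpos_of_nonneg_of_nonpos zero_le_one hc
      linarith
    have h2 : 2 < 1 / (x + u) := by linarith
    have h3 := h2
    rw [lt_div_iff₀ hp] at h2
    have : ⌊x⌋ = -u := by
      rw [Int.floor_eq_iff]; push_cast; constructor <;> linarith
    rw [hu, this, neg_neg]
    refine ⟨?_, rfl⟩
    rw [hn1, hu, this, Int.le_floor]
    push_cast
    rw [sub_neg_eq_add]
    exact h3.le
  · left
    obtain rfl : b = -1 - u := by omega
    have e : (-1 * x + ((-1 - u : ℤ) : ℝ)) / (x + u) = -1 / (x + u) - 1 := by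
      push_cast; field_simp; ring
    rw [e] at h
    have hp : x + u < 0 := by
      by_contra! hc
      have := div_nonpos_of_nonpos_of_nonneg (by norm_num : (-1 : ℝ) ≤ 0) hc
      linarith
    have h2 : 2 < -1 / (x + u) := by linarith
    rw [lt_div_iff_of_neg hp] at h2
    have : ⌊x⌋ = -u - 1 := by
      rw [Int.floor_eq_iff]; push_cast; constructor <;> linarith
    have h4 : cfN x 1 = 1 := by
      have hpos : 0 < x + u + 1 := by linarith
      rw [hn1, hu, this, Int.floor_eq_iff]
      push_cast
      rw [show x - (-(u : ℝ) - 1) = x + u + 1 by ring, le_div_iff₀ hpos, div_lt_iff₀ hpos]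
      constructor <;> linarith
    rw [h4, hu, this]
    ext j k
    fin_cases j <;> fin_cases k <;> simp <;> ring

/-- Descent along the Euclidean algorithm on the first column `(-a, t)`. -/
lemma eq_gam_or_exceptional {x : ℝ} (hx : Irrational x) (a b t u : ℤ) (ha : 0 ≤ a) (hat : a ≤ t)
    (ht : 0 < t) (hd : -a * u - b * t = 1 ∨ -a * u - b * t = -1)
    (h : 1 < moeb !![-a, b; t, u] x) :
    (∃ i, 1 ≤ i ∧ (!![-a, b; t, u] = gam x i ∨ !![-a, b; t, u] = -gam x i)) ∨
      !![-a, b; t, u] = !![0, -1; 1, -(1 + cfN x 0)] ∨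
      2 ≤ cfN x 1 ∧ !![-a, b; t, u] = !![-1, 1 + cfN x 0; 1, -(cfN x 0)] := by
  have dvd_one : ∀ c : ℤ, c ∣ -a * u - b * t → 0 < c → c = 1 := by
    intro c hc hc0
    have : c ∣ 1 := by
      rcases hd with hd | hd <;> rw [hd] at hc
      · exact hc
      · exact (dvd_neg).mp hc
    exact Int.eq_one_of_dvd_one hc0.le this
  rcases ha.eq_or_lt with rfl | ha0
  · obtain rfl := dvd_one t ⟨-b, by ring⟩ ht
    rw [neg_zero] at *
    rcases eq_gam_of_top_left_zero (by omega) h with h1 | h1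
    · exact Or.inl ⟨1, le_rfl, Or.inl h1⟩
    · exact Or.inr (Or.inl h1)
  rcases hat.eq_or_lt with rfl | hlt
  · obtain rfl := dvd_one a ⟨-u - b, by ring⟩ ht
    rcases eq_gam_of_top_left_neg_one hx (by omega) h with h1 | h1
    · exact Or.inl ⟨2, by norm_num, Or.inr h1⟩
    · exact Or.inr (Or.inr h1)
  left
  have key : ∀ n : ℤ, 1 ≤ n →
      (∃ i, 1 ≤ i ∧ (!![-(t - n * a), -(u + n * b); a, -b] = gam x i ∨
        !![-(t - n * a), -(u + n * b); a, -b] = -gam x i)) →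
      ∃ i, 1 ≤ i ∧ (!![-a, b; t, u] = gam x i ∨ !![-a, b; t, u] = -gam x i) := by
    rintro n hn ⟨i, -, hi⟩
    exact ⟨i + 1, by omega, eq_gam_succ_of_predecessor hx hn h hi⟩
  have hgt : ∀ n : ℤ, 1 ≤ n → 1 < moeb !![-(t - n * a), -(u + n * b); a, -b] x := by
    intro n hn
    rw [moeb_predecessor h]
    exact (one_lt_and_floor_of_inv h hn).1
  have hdet : ∀ n : ℤ, -(t - n * a) * -b - -(u + n * b) * a = -(-a * u - b * t) := by
    intro n; ring
  set n := t / a with hn_def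
  have hn : 1 ≤ n := by
    rw [hn_def, Int.le_ediv_iff_mul_le ha0]; omega
  have hmod : t - n * a = t % a := by
    rw [Int.emod_def, hn_def]
    ring
  have hm0 := Int.emod_nonneg t ha0.ne'
  have hm1 := Int.emod_lt_of_pos t ha0
  have hd' := hdet n
  rcases eq_gam_or_exceptional hx (t - n * a) (-(u + n * b)) a (-b) (by omega) (by omega) ha0
    (by omega) (hgt n hn) with h1 | h1 | ⟨-, h1⟩
  · exact key n hn h1
  · have e1 := congrFun (congrFun h1 0) 0
    have e2 := congrFun (congrFun h1 0) 1
    have e3 := congrFun (congrFun h1 1) 0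
    have e4 := congrFun (congrFun h1 1) 1
    simp only [Matrix.of_apply, Matrix.cons_val', Matrix.cons_val_zero, Matrix.cons_val_one,
      Matrix.cons_val_fin_one] at e1 e2 e3 e4
    have hdn := hdet (n - 1)
    have f1 : t - (n - 1) * a = 1 := by linarith
    refine key (n - 1) (by subst e3; omega) ?_
    rcases eq_gam_of_top_left_neg_one hx (b := -(u + (n - 1) * b)) (u := -b)
      (by rw [f1, e3] at hdn; rw [e3] at hd; omega)
      (by have := hgt (n - 1) (by subst e3; omega); rwa [f1, e3] at this) with h2 | ⟨-, h2⟩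
    · exact ⟨2, by norm_num, Or.inr (by rw [f1, e3]; exact h2)⟩
    · have e5 := congrFun (congrFun h2 1) 1
      simp only [Matrix.of_apply, Matrix.cons_val', Matrix.cons_val_one,
        Matrix.cons_val_fin_one] at e5
      omega
  · have e1 := congrFun (congrFun h1 0) 0
    have e3 := congrFun (congrFun h1 1) 0
    simp only [Matrix.of_apply, Matrix.cons_val', Matrix.cons_val_zero, Matrix.cons_val_one,
      Matrix.cons_val_fin_one] at e1 e3
    omega
termination_by t.toNat
decreasing_by omega

lemma gam_ne_exceptional {x : ℝ} (hx : Irrational x) {i : ℕ} (hi : 1 ≤ i) :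
    (gam x i ≠ !![0, -1; 1, -(1 + cfN x 0)] ∧ gam x i ≠ -!![0, -1; 1, -(1 + cfN x 0)]) ∧
    (2 ≤ cfN x 1 → gam x i ≠ !![-1, 1 + cfN x 0; 1, -(cfN x 0)] ∧
      gam x i ≠ -!![-1, 1 + cfN x 0; 1, -(cfN x 0)]) := by
  obtain rfl | rfl | ⟨j, rfl⟩ : i = 1 ∨ i = 2 ∨ ∃ j, i = j + 3 := by
    rcases i with _ | _ | _ | j
    · omega
    · simp
    · simp
    · exact Or.inr (Or.inr ⟨j, rfl⟩)
  · rw [gam_one]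
    refine ⟨⟨?_, ?_⟩, fun _ => ⟨?_, ?_⟩⟩ <;> intro h
    · simpa using congrFun (congrFun h 0) 1
    · simpa using congrFun (congrFun h 1) 0
    · simpa using congrFun (congrFun h 0) 0
    · simpa using congrFun (congrFun h 0) 0
  · rw [gam_two]
    refine ⟨⟨?_, ?_⟩, fun h2 => ⟨?_, ?_⟩⟩ <;> intro h
    · simpa using congrFun (congrFun h 0) 0
    · simpa using congrFun (congrFun h 0) 0
    · simpa using congrFun (congrFun h 0) 0
    · have := congrFun (congrFun h 1) 0
      simp at this
      omega
  · obtain ⟨h0, h1⟩ := gam_add_three_column hx j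
    refine ⟨⟨?_, ?_⟩, fun _ => ⟨?_, ?_⟩⟩ <;> intro h <;> rw [h] at h0 h1 <;> simp at h0 h1

lemma exists_normalized {M : Mat2} (ht : M 1 0 ≠ 0) (h1 : -1 ≤ (M 0 0 : ℝ) / (M 1 0 : ℝ))
    (h2 : (M 0 0 : ℝ) / (M 1 0 : ℝ) ≤ 0) :
    ∃ N : Mat2, (M = N ∨ M = -N) ∧ 0 < N 1 0 ∧ N 0 0 ≤ 0 ∧ -N 0 0 ≤ N 1 0 := by
  rcases lt_or_gt_of_ne ht with h | h
  · have h' : (M 1 0 : ℝ) < 0 := by exact_mod_cast h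
    rw [le_div_iff_of_neg h'] at h1
    rw [div_le_iff_of_neg h', zero_mul] at h2
    norm_cast at h2
    have h1' : M 0 0 ≤ -1 * M 1 0 := by exact_mod_cast h1
    refine ⟨-M, Or.inr (neg_neg M).symm, ?_, ?_, ?_⟩ <;> simp only [Matrix.neg_apply] <;> omega
  · have h' : (0 : ℝ) < (M 1 0 : ℝ) := by exact_mod_cast h
    rw [le_div_iff₀ h'] at h1
    rw [div_le_iff₀ h', zero_mul] at h2
    norm_cast at h2
    have h1' : -1 * M 1 0 ≤ M 0 0 := by exact_mod_cast h1
    exact ⟨M, Or.inl rfl, h, h2, by omega⟩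

lemma gam_mem_window {x : ℝ} (hx : Irrational x) {i : ℕ} (hi : 1 ≤ i) :
    gam x i 1 0 ≠ 0 ∧ -1 ≤ (gam x i 0 0 : ℝ) / (gam x i 1 0 : ℝ) ∧
      (gam x i 0 0 : ℝ) / (gam x i 1 0 : ℝ) ≤ 0 ∧ 1 < moeb (gam x i) x := by
  obtain ⟨j, rfl⟩ := Nat.exists_eq_add_of_le' hi
  rw [moeb_gam hx]
  rcases gam_succ_column hx j with ⟨h1, h2, h3⟩ | ⟨h1, h2, h3⟩
  · have h1' : (gam x (j + 1) 0 0 : ℝ) ≤ 0 := by exact_mod_cast h1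
    have h2' : 0 < (gam x (j + 1) 1 0 : ℝ) := by exact_mod_cast h2
    have h3' : -(gam x (j + 1) 0 0 : ℝ) ≤ gam x (j + 1) 1 0 := by exact_mod_cast h3
    refine ⟨h2.ne', ?_, ?_, one_lt_cfX_succ hx j⟩
    · rw [le_div_iff₀ h2']; linarith
    · exact div_nonpos_of_nonpos_of_nonneg h1' h2'.le
  · have h1' : 0 ≤ (gam x (j + 1) 0 0 : ℝ) := by exact_mod_cast h1
    have h2' : (gam x (j + 1) 1 0 : ℝ) < 0 := by exact_mod_cast h2
    have h3' : (gam x (j + 1) 0 0 : ℝ) ≤ -gam x (j + 1) 1 0 := by exact_mod_cast h3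
    refine ⟨h2.ne, ?_, ?_, one_lt_cfX_succ hx j⟩
    · rw [le_div_iff_of_neg h2']; linarith
    · exact div_nonpos_of_nonneg_of_nonpos h1' h2'.le

/-- **Proposition 1 of the paper.** For irrational `x`, as subsets of
`PGL₂(ℤ)` (encoded here as sets of integer matrices of unit determinant closed under
negation), `Γ(x) = W \ (W₁ ∪ W₂)` where `W = {γ : -1 ≤ γ(∞) ≤ 0, γ(x) > 1}`,
`W₁ = {[[0,-1],[1,-1-n₀]]}` and `W₂ = {[[-1,1+n₀],[1,-n₀]]}` if `n₁ ≥ 2`, `W₂ = ∅`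
if `n₁ = 1`. -/
theorem stmt7 (x : ℝ) (hx : Irrational x) :
    {M : Mat2 | ∃ i, 1 ≤ i ∧ (M = gam x i ∨ M = -gam x i)} =
      {M : Mat2 | IsUnit M.det ∧ M 1 0 ≠ 0 ∧
          -1 ≤ (M 0 0 : ℝ) / (M 1 0 : ℝ) ∧ (M 0 0 : ℝ) / (M 1 0 : ℝ) ≤ 0 ∧
          1 < moeb M x} \
        ({M : Mat2 | M = !![0, -1; 1, -(1 + cfN x 0)] ∨
            M = -!![0, -1; 1, -(1 + cfN x 0)]} ∪
         {M : Mat2 | 2 ≤ cfN x 1 ∧ (M = !![-1, 1 + cfN x 0; 1, -(cfN x 0)] ∨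
            M = -!![-1, 1 + cfN x 0; 1, -(cfN x 0)])}) := by
  ext M
  simp only [Set.mem_sdiff, Set.mem_union, Set.mem_ofPred_eq]
  constructor
  · rintro ⟨i, hi, hM⟩
    obtain ⟨h1, h2, h3, h4⟩ := gam_mem_window hx hi
    obtain ⟨⟨n1, n2⟩, n3⟩ := gam_ne_exceptional hx hi
    rcases hM with rfl | rfl
    · refine ⟨⟨isUnit_det_gam x i, h1, h2, h3, h4⟩, ?_⟩
      rintro ((h | h) | ⟨h2, h | h⟩)
      exacts [n1 h, n2 h, (n3 h2).1 h, (n3 h2).2 h]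
    · refine ⟨⟨?_, ?_, ?_, ?_, ?_⟩, ?_⟩
      · rw [Matrix.det_neg]
        simpa using isUnit_det_gam x i
      · simpa using h1
      · simpa only [Matrix.neg_apply, Int.cast_neg, neg_div_neg_eq] using h2
      · simpa only [Matrix.neg_apply, Int.cast_neg, neg_div_neg_eq] using h3
      · rwa [moeb_neg]
      · rintro ((h | h) | ⟨h2, h | h⟩)
        exacts [n2 (neg_eq_iff_eq_neg.mp h), n1 (neg_injective h),
          (n3 h2).2 (neg_eq_iff_eq_neg.mp h), (n3 h2).1 (neg_injective h)]
  · rintro ⟨⟨hd, ht, h1, h2, h3⟩, hne⟩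
    obtain ⟨N, hMN, hN1, hN2, hN3⟩ := exists_normalized ht h1 h2
    have hdN : IsUnit N.det := by
      rcases hMN with rfl | rfl
      · exact hd
      · rw [Matrix.det_neg] at hd
        simpa using hd
    have hmN : 1 < moeb N x := by
      rcases hMN with rfl | rfl
      · exact h3
      · rwa [moeb_neg] at h3
    have hN : N = !![-(-N 0 0), N 0 1; N 1 0, N 1 1] := by
      rw [neg_neg]
      exact Matrix.eta_fin_two N
    rw [Matrix.det_fin_two, Int.isUnit_iff] at hdN
    rw [hN] at hmN
    have key := eq_gam_or_exceptional hx (-N 0 0) (N 0 1) (N 1 0) (N 1 1) (by omega) hN3 hN1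
      (by rwa [neg_neg]) hmN
    rw [← hN] at key
    rcases key with ⟨i, hi, hg⟩ | hg | ⟨h2, hg⟩
    · refine ⟨i, hi, ?_⟩
      rcases hMN with rfl | rfl
      · exact hg
      · rcases hg with hg | hg
        · exact Or.inr (by rw [hg])
        · exact Or.inl (by rw [hg, neg_neg])
    · exact absurd (Or.inl (by rwa [← hg])) hne
    · exact absurd (Or.inr ⟨h2, by rwa [← hg]⟩) hne
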